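/- Let q = 2^r with r a positive integer, and let a ∈ 𝔽_q^*. Then Σ_{w ∈ SO⁺(4,q)} λ(a · Tr w) = q²(K(λ;a)² + q³ − q) = q²(K₂(λ;a) + q³), where Tr w is the matrix trace of w. -/

import Mathlib

open Finset Matrix

/-- The quadratic form `θ⁺(x) = ∑ i, x_i x_{n+i}` on `F^{2n}` (columns indexed by `Fin n ⊕ Fin n`). -/
def thetaPlus (F : Type) [Field F] (n : ℕ) (x : Fin n ⊕ Fin n → F) : F :=
  ∑ i : Fin n, x (Sum.inl i) * x (Sum.inr i)

/-- The orthogonal group `O⁺(2n,q)`: invertible matrices preserving `θ⁺`. -/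
noncomputable def OplusGrp (F : Type) [Field F] [Fintype F] [DecidableEq F] (n : ℕ) :
    Finset (Matrix (Fin n ⊕ Fin n) (Fin n ⊕ Fin n) F) := by
  classical
  exact Finset.univ.filter (fun w => IsUnit w ∧
    ∀ x : Fin n ⊕ Fin n → F, thetaPlus F n (w.mulVec x) = thetaPlus F n x)

/-- `SO⁺(2n,q)`: the kernel of `δ⁺(w) = Tr(B ᵗC)` on `O⁺(2n,q)`,
where `w = [[A,B],[C,D]]` in `n × n` blocks. -/
noncomputable def SOplusGrp (F : Type) [Field F] [Fintype F] [DecidableEq F] (n : ℕ) :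
    Finset (Matrix (Fin n ⊕ Fin n) (Fin n ⊕ Fin n) F) := by
  classical
  exact (OplusGrp F n).filter
    (fun w => Matrix.trace (Matrix.toBlocks₁₂ w * (Matrix.toBlocks₂₁ w)ᵀ) = 0)

/-- The trace map `tr(x) = x + x² + ⋯ + x^{2^{r−1}}`, valued in `𝔽₂ = {0,1} ⊆ F`. -/
def trF (F : Type) [Field F] (r : ℕ) (x : F) : F := ∑ i ∈ Finset.range r, x ^ 2 ^ i

/-- The canonical additive character `λ(x) = (−1)^{tr(x)} ∈ {±1} ⊆ ℤ`. -/
noncomputable def lam (F : Type) [Field F] (r : ℕ) (x : F) : ℤ := by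
  classical exact if trF F r x = 0 then 1 else -1

/-- The trace map `tr` viewed as a function into `𝔽₂ = ZMod 2`. -/
noncomputable def tr2 (F : Type) [Field F] (r : ℕ) (x : F) : ZMod 2 := by
  classical exact if trF F r x = 0 then 0 else 1

/-- The Kloosterman sum `K(λ;a) = ∑_{α ∈ F*} λ(α + aα⁻¹)`. -/
noncomputable def Kl (F : Type) [Field F] [Fintype F] (r : ℕ) (a : F) : ℤ := by
  classical
  exact ∑ α ∈ Finset.univ.filter (fun α : F => α ≠ 0), lam F r (α + a * α⁻¹)

/-- The `m`-dimensional Kloosterman sum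
`K_m(λ;a) = ∑_{α₁,…,α_m ∈ F*} λ(α₁ + ⋯ + α_m + aα₁⁻¹⋯α_m⁻¹)`;
for `m = 0` this is `K₀(λ;a) = λ(a)`. -/
noncomputable def Klm (F : Type) [Field F] [Fintype F] (r m : ℕ) (a : F) : ℤ := by
  classical
  exact ∑ v ∈ Finset.univ.filter (fun v : Fin m → F => ∀ i, v i ≠ 0),
    lam F r ((∑ i, v i) + a * (∏ i, v i)⁻¹)

/-- The power moment `MK^h = ∑_{a ∈ F*} K(λ;a)^h`. -/
noncomputable def MK (F : Type) [Field F] [Fintype F] (r h : ℕ) : ℤ := by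
  classical exact ∑ a ∈ Finset.univ.filter (fun a : F => a ≠ 0), (Kl F r a) ^ h

/-- The power moment `MK₂^h = ∑_{a ∈ F*} K₂(λ;a)^h` of 2-dimensional Kloosterman sums. -/
noncomputable def MK2 (F : Type) [Field F] [Fintype F] (r h : ℕ) : ℤ := by
  classical exact ∑ a ∈ Finset.univ.filter (fun a : F => a ≠ 0), (Klm F r 2 a) ^ h

/-- The binary code `C(G) = {u ∈ 𝔽₂^G : ∑_{g ∈ G} u_g Tr(g) = 0 in F}`. -/
noncomputable def code (F : Type) [Field F] [Fintype F] [DecidableEq F]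
    {ι : Type} [Fintype ι] [DecidableEq ι] (G : Finset (Matrix ι ι F)) :
    Finset (↥G → ZMod 2) := by
  classical
  exact Finset.univ.filter
    (fun u => ∑ g : ↥G, (u g).val • Matrix.trace (g : Matrix ι ι F) = 0)

/-- Number of codewords of Hamming weight `j` in the code `C(G)`. -/
noncomputable def wtCount (F : Type) [Field F] [Fintype F] [DecidableEq F]
    {ι : Type} [Fintype ι] [DecidableEq ι] (G : Finset (Matrix ι ι F)) (j : ℕ) : ℕ := by
  classical
  exact ((code F G).filter
    (fun u => (Finset.univ.filter (fun g : ↥G => u g = 1)).card = j)).card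

/-- `t! · S(h,t)` where `S(h,t)` is the Stirling number of the second kind,
`S(h,t) = (1/t!) ∑_{j=0}^{t} (−1)^{t−j} C(t,j) j^h`. -/
def tS (h t : ℕ) : ℤ :=
  ∑ j ∈ Finset.range (t + 1), (-1 : ℤ) ^ (t - j) * (t.choose j : ℤ) * (j : ℤ) ^ h

/-- Binomial coefficient with integer arguments: `0` whenever `k < 0` or `k > n`. -/
def ichoose (n k : ℤ) : ℤ := if 0 ≤ k ∧ k ≤ n then (n.toNat.choose k.toNat : ℤ) else 0

section CanonicalCharacter

variable {F : Type} [Field F] {r : ℕ}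

theorem trF_add [CharP F 2] (x y : F) : trF F r (x + y) = trF F r x + trF F r y := by
  simp only [trF, ← Finset.sum_add_distrib]
  exact Finset.sum_congr rfl fun i _ => add_pow_char_pow x y 2 i

theorem sq_trF [CharP F 2] (x : F) : trF F r x ^ 2 = trF F r (x ^ 2) := by
  simp only [trF, ← frobenius_def 2, map_sum]
  exact Finset.sum_congr rfl fun i _ => by rw [← map_pow]

theorem lam_of_trF_eq_zero {x : F} (h : trF F r x = 0) : lam F r x = 1 := if_pos h

theorem lam_of_trF_ne_zero {x : F} (h : trF F r x ≠ 0) : lam F r x = -1 := if_neg h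

theorem lam_zero : lam F r 0 = 1 := lam_of_trF_eq_zero (by simp [trF])

variable [Fintype F]

theorem charP_two_of_card (hF : Fintype.card F = 2 ^ r) : CharP F 2 := by
  refine CharTwo.of_one_ne_zero_of_two_eq_zero one_ne_zero ?_
  have h : ((Fintype.card F : ℕ) : F) = 0 := FiniteField.cast_card_eq_zero F
  rw [hF] at h
  push_cast at h
  exact eq_zero_of_pow_eq_zero h

theorem trF_sq (hF : Fintype.card F = 2 ^ r) (x : F) : trF F r (x ^ 2) = trF F r x := by
  have h1 := Finset.sum_range_succ (fun i => x ^ 2 ^ i) r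
  have h2 := Finset.sum_range_succ' (fun i => x ^ 2 ^ i) r
  have h3 : x ^ 2 ^ r = x := by rw [← hF, FiniteField.pow_card]
  simp only [h3, pow_zero, pow_one] at h1 h2
  simp only [trF, ← pow_mul, ← pow_succ']
  exact add_right_cancel (h2.symm.trans h1)

theorem trF_eq_zero_or_one [CharP F 2] (hF : Fintype.card F = 2 ^ r) (x : F) :
    trF F r x = 0 ∨ trF F r x = 1 := by
  have h : trF F r x ^ 2 = trF F r x := by rw [sq_trF, trF_sq hF]
  have h' : trF F r x * (trF F r x - 1) = 0 := by linear_combination h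
  rcases mul_eq_zero.1 h' with h | h
  · exact Or.inl h
  · exact Or.inr (sub_eq_zero.1 h)

theorem lam_add [CharP F 2] (hF : Fintype.card F = 2 ^ r) (x y : F) :
    lam F r (x + y) = lam F r x * lam F r y := by
  have h := trF_add (r := r) x y
  have lam_one : ∀ {z : F}, trF F r z = 1 → lam F r z = -1 := fun hz =>
    lam_of_trF_ne_zero (by simp [hz])
  rcases trF_eq_zero_or_one hF x with hx | hx <;> rcases trF_eq_zero_or_one hF y with hy | hy <;>
    simp only [hx, hy, add_zero, zero_add, CharTwo.add_self_eq_zero] at h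
  · rw [lam_of_trF_eq_zero hx, lam_of_trF_eq_zero hy, lam_of_trF_eq_zero h, mul_one]
  · rw [lam_of_trF_eq_zero hx, lam_one hy, lam_one h, one_mul]
  · rw [lam_one hx, lam_of_trF_eq_zero hy, lam_one h, mul_one]
  · rw [lam_one hx, lam_one hy, lam_of_trF_eq_zero h, neg_one_mul, neg_neg]

theorem lam_sq (hF : Fintype.card F = 2 ^ r) (x : F) : lam F r (x ^ 2) = lam F r x := by
  have h := trF_sq hF x
  by_cases hx : trF F r x = 0
  · rw [lam_of_trF_eq_zero hx, lam_of_trF_eq_zero (h.trans hx)]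
  · rw [lam_of_trF_ne_zero hx, lam_of_trF_ne_zero (h ▸ hx)]

theorem exists_lam_ne_one (hr : 1 ≤ r) (hF : Fintype.card F = 2 ^ r) :
    ∃ x : F, lam F r x ≠ 1 := by
  classical
  by_contra! h
  obtain ⟨s, rfl⟩ : ∃ s, r = s + 1 := ⟨r - 1, by omega⟩
  let P : Polynomial F := ∑ i ∈ Finset.range (s + 1), Polynomial.X ^ 2 ^ i
  have hdeg : P.natDegree ≤ 2 ^ s := by
    refine Polynomial.natDegree_sum_le_of_forall_le _ _ fun i hi => ?_
    rw [Polynomial.natDegree_X_pow]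
    exact Nat.pow_le_pow_right two_pos (by simpa [Nat.lt_succ_iff] using hi)
  have hP : P = 0 := by
    refine Polynomial.eq_zero_of_natDegree_lt_card_of_eval_eq_zero' P Finset.univ (fun x _ => ?_) ?_
    · have hx := h x
      have hx' : trF F (s + 1) x = 0 := by
        by_contra h0
        simp [lam_of_trF_ne_zero h0] at hx
      simpa [P, trF, Polynomial.eval_finsetSum] using hx'
    · rw [Finset.card_univ, hF]
      exact hdeg.trans_lt (Nat.pow_lt_pow_right one_lt_two (Nat.lt_succ_self s))
  have hc : P.coeff (2 ^ s) = 1 := by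
    simp only [P, Polynomial.finsetSum_coeff, Polynomial.coeff_X_pow]
    rw [Finset.sum_eq_single s]
    · simp
    · intro b _ hb
      rw [if_neg]
      exact fun h => hb (Nat.pow_right_injective le_rfl h).symm
    · simp
  rw [hP] at hc
  simp at hc

theorem sum_lam [CharP F 2] (hr : 1 ≤ r) (hF : Fintype.card F = 2 ^ r) :
    ∑ x : F, lam F r x = 0 := by
  obtain ⟨y, hy⟩ := exists_lam_ne_one hr hF
  have h : lam F r y * ∑ x : F, lam F r x = ∑ x : F, lam F r x := by
    rw [Finset.mul_sum, ← Equiv.sum_comp (Equiv.addLeft y) (fun x => lam F r x)]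
    exact Finset.sum_congr rfl fun x _ => by simp [lam_add hF]
  have h' : (lam F r y - 1) * ∑ x : F, lam F r x = 0 := by linear_combination h
  exact (mul_eq_zero.1 h').resolve_left (sub_ne_zero.2 hy)

theorem sum_lam_mul [DecidableEq F] [CharP F 2] (hr : 1 ≤ r) (hF : Fintype.card F = 2 ^ r)
    (b : F) : ∑ x : F, lam F r (b * x) = if b = 0 then 2 ^ r else 0 := by
  split_ifs with hb
  · simp [hb, lam_zero, hF]
  · rw [← sum_lam hr hF]
    exact Equiv.sum_comp (Equiv.mulLeft₀ b hb) (fun x => lam F r x)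

theorem sum_eq_add_sum_units [DecidableEq F] (f : F → ℤ) :
    ∑ x, f x = f 0 + ∑ u : Fˣ, f u := by
  rw [← Finset.add_sum_erase _ _ (Finset.mem_univ (0 : F))]
  congr 1
  symm
  refine Finset.sum_bij' (fun u _ => (u : F)) (fun x hx => Units.mk0 x (by simpa using hx))
    ?_ ?_ ?_ ?_ ?_ <;> simp

theorem sum_units_lam_mul [DecidableEq F] [CharP F 2] (hr : 1 ≤ r)
    (hF : Fintype.card F = 2 ^ r) {b : F} (hb : b ≠ 0) :
    ∑ u : Fˣ, lam F r (b * u) = -1 := by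
  have h := sum_eq_add_sum_units (fun x => lam F r (b * x))
  rw [sum_lam_mul hr hF, if_neg hb, mul_zero, lam_zero] at h
  linarith

theorem card_artinSchreier_fiber [DecidableEq F] [CharP F 2] (hr : 1 ≤ r)
    (hF : Fintype.card F = 2 ^ r) (c : F) :
    ((Finset.univ.filter fun z : F => z ^ 2 + z = c).card : ℤ) = 1 + lam F r c := by
  have hq : (2 ^ r : ℤ) ≠ 0 := by positivity
  have h1 : ∑ z : F, ∑ u : F, lam F r ((z ^ 2 + z + c) * u) =
      2 ^ r * ((Finset.univ.filter fun z : F => z ^ 2 + z = c).card : ℤ) := by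
    simp only [sum_lam_mul hr hF, CharTwo.add_eq_zero]
    rw [← Finset.sum_filter, Finset.sum_const, nsmul_eq_mul, mul_comm]
  have h2 : ∀ u : F, ∑ z : F, lam F r ((z ^ 2 + z + c) * u) =
      lam F r (c * u) * if u = 0 ∨ u = 1 then 2 ^ r else 0 := by
    intro u
    have h3 : ∀ z, lam F r ((z ^ 2 + z + c) * u) = lam F r (c * u) * lam F r ((u + u ^ 2) * z ^ 2) := by
      intro z
      rw [show (z ^ 2 + z + c) * u = c * u + (u * z ^ 2 + u * z) by ring, lam_add hF, lam_add hF,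
        ← lam_sq hF (u * z), ← lam_add hF]
      congr 2
      ring
    simp only [h3, ← Finset.mul_sum]
    congr 1
    have h4 : ∑ z : F, lam F r ((u + u ^ 2) * z ^ 2) = ∑ z : F, lam F r ((u + u ^ 2) * z) :=
      Equiv.sum_comp (frobeniusEquiv F 2).toEquiv fun z => lam F r ((u + u ^ 2) * z)
    rw [h4, sum_lam_mul hr hF]
    congr 1
    rw [show u + u ^ 2 = u * (1 + u) by ring, mul_eq_zero, CharTwo.add_eq_zero, eq_comm (a := 1)]
  rw [Finset.sum_comm, Finset.sum_congr rfl fun u _ => h2 u] at h1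
  simp only [mul_ite, mul_zero] at h1
  rw [← Finset.sum_filter, show (Finset.univ.filter fun u : F => u = 0 ∨ u = 1) = {0, 1} by
    ext; simp, Finset.sum_pair zero_ne_one, mul_zero, lam_zero, mul_one] at h1
  apply mul_left_cancel₀ hq
  linarith

theorem sum_artinSchreier [DecidableEq F] [CharP F 2] (hr : 1 ≤ r)
    (hF : Fintype.card F = 2 ^ r) (f : F → ℤ) :
    ∑ z : F, f (z ^ 2 + z) = ∑ c, (1 + lam F r c) * f c := by
  rw [← Finset.sum_fiberwise' Finset.univ (fun z : F => z ^ 2 + z) f]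
  refine Finset.sum_congr rfl fun c _ => ?_
  rw [Finset.sum_const, nsmul_eq_mul, card_artinSchreier_fiber hr hF]

end CanonicalCharacter

section KloostermanSums

variable {F : Type} [Field F] [Fintype F] [DecidableEq F] {r : ℕ}

theorem Kl_eq_sum_units (a : F) : Kl F r a = ∑ u : Fˣ, lam F r (u + a * (u : F)⁻¹) := by
  symm
  refine Finset.sum_bij' (fun u _ => (u : F)) (fun x hx => Units.mk0 x (by simpa using hx))
    ?_ ?_ ?_ ?_ ?_ <;> simp

theorem Klm_two_eq_sum_units (a : F) :
    Klm F r 2 a = ∑ u : Fˣ, ∑ v : Fˣ, lam F r (u + v + a * ((u : F) * v)⁻¹) := by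
  rw [← Fintype.sum_prod_type']
  symm
  refine Finset.sum_bij' (fun p _ => ![(p.1 : F), p.2])
    (fun v hv => (Units.mk0 (v 0) (by simp at hv; exact hv.1),
      Units.mk0 (v 1) (by simp at hv; exact hv.2))) ?_ ?_ ?_ ?_ ?_
  · simp
  · simp
  · simp
  · intro v _
    ext i
    fin_cases i <;> rfl
  · simp

theorem sum_units_sq [CharP F 2] (f : Fˣ → ℤ) : ∑ u : Fˣ, f (u ^ 2) = ∑ u, f u := by
  rw [← Equiv.sum_comp (Units.mapEquiv (frobeniusEquiv F 2).toMulEquiv).toEquiv f]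
  refine Finset.sum_congr rfl fun u _ => congrArg f ?_
  ext
  rfl

theorem sum_units_lam_mul_add_inv [CharP F 2] (hF : Fintype.card F = 2 ^ r) {a : F}
    (ha : a ≠ 0) : ∑ u : Fˣ, lam F r (a * (u + (u : F)⁻¹)) = Kl F r a := by
  have h1 : ∑ u : Fˣ, lam F r (a * (u + (u : F)⁻¹)) =
      ∑ u : Fˣ, lam F r (u + a ^ 2 * (u : F)⁻¹) := by
    rw [← Equiv.sum_comp (Equiv.mulLeft (Units.mk0 a ha)) fun u : Fˣ =>
      lam F r (u + a ^ 2 * (u : F)⁻¹)]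
    refine Finset.sum_congr rfl fun u _ => congrArg _ ?_
    simp only [Equiv.coe_mulLeft, Units.val_mul, Units.val_mk0]
    field_simp
  rw [h1, Kl_eq_sum_units, ← sum_units_sq fun u : Fˣ => lam F r (u + a ^ 2 * (u : F)⁻¹)]
  refine Finset.sum_congr rfl fun u _ => ?_
  rw [← lam_sq hF (u + a * (u : F)⁻¹), CharTwo.add_sq, Units.val_pow_eq_pow_val, mul_pow, inv_pow]

theorem sum_units_lam_mul_add_inv_mul_add_inv [CharP F 2] (hF : Fintype.card F = 2 ^ r) {a : F}
    (ha : a ≠ 0) :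
    ∑ v : Fˣ, ∑ u : Fˣ, lam F r (a * ((u : F) + (u : F)⁻¹) * (v + (v : F)⁻¹)) =
      Kl F r a ^ 2 := by
  let f : Fˣ → ℤ := fun u => lam F r (a * (u + (u : F)⁻¹))
  have h1 : ∀ u v : Fˣ, lam F r (a * ((u : F) + (u : F)⁻¹) * (v + (v : F)⁻¹)) =
      f (u * v) * f (u * v⁻¹) := by
    intro u v
    simp only [f]
    rw [← lam_add hF]
    congr 1
    simp only [Units.val_mul, Units.val_inv_eq_inv_val, mul_inv, inv_inv]
    ring
  calc _ = ∑ v : Fˣ, ∑ u : Fˣ, f (u * v ^ 2) * f u := by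
        refine Finset.sum_congr rfl fun v _ => ?_
        simp only [h1]
        rw [← Equiv.sum_comp (Equiv.mulRight v)]
        refine Finset.sum_congr rfl fun u _ => ?_
        simp [mul_assoc, sq]
    _ = ∑ v : Fˣ, ∑ u : Fˣ, f (u * v) * f u :=
        sum_units_sq fun v => ∑ u : Fˣ, f (u * v) * f u
    _ = ∑ u : Fˣ, (∑ v : Fˣ, f v) * f u := by
        rw [Finset.sum_comm]
        refine Finset.sum_congr rfl fun u _ => ?_
        rw [← Finset.sum_mul]
        congr 1
        exact Equiv.sum_comp (Equiv.mulLeft u) f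
    _ = Kl F r a ^ 2 := by
        rw [← Finset.mul_sum, sum_units_lam_mul_add_inv hF ha, sq]

theorem Kl_sq_eq [CharP F 2] (hr : 1 ≤ r) (hF : Fintype.card F = 2 ^ r) {a : F} (ha : a ≠ 0) :
    Kl F r a ^ 2 = Klm F r 2 a + 2 ^ r := by
  let G : F → ℤ := fun c => ∑ s : Fˣ, lam F r (s + a * (s : F)⁻¹ * c⁻¹)
  let p : F → F := fun t => ((1 + t)⁻¹) ^ 2 + (1 + t)⁻¹
  have hcard : (Fintype.card Fˣ : ℤ) = 2 ^ r - 1 := by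
    rw [Fintype.card_units, hF, Nat.cast_sub Nat.one_le_two_pow]
    simp
  have hG0 : G 0 = -1 := by
    have h := sum_units_lam_mul hr hF (one_ne_zero (α := F))
    simpa [G] using h
  have hsum : ∑ t, G (p t) = ∑ c, (1 + lam F r c) * G c := by
    rw [← sum_artinSchreier hr hF]
    exact Equiv.sum_comp ((Equiv.addLeft (1 : F)).trans (Equiv.inv F)) fun z => G (z ^ 2 + z)
  have hp0 : p 0 = 0 := by simp [p, CharTwo.add_self_eq_zero]
  have hp1 : p 1 = 0 := by simp [p, CharTwo.add_self_eq_zero]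
  have hterm : ∀ t : Fˣ, ∑ u : Fˣ, lam F r ((u : F) * (1 + t) + a * (u : F)⁻¹ * (1 + (t : F)⁻¹)) =
      G (p t) + if t = 1 then 2 ^ r else 0 := by
    intro t
    split_ifs with ht
    · subst ht
      simp [hp1, hG0, CharTwo.add_self_eq_zero, lam_zero, hcard]
      ring
    · have ht' : (1 + t : F) ≠ 0 := by
        rw [Ne, CharTwo.add_eq_zero]
        exact fun h => ht (Units.ext h.symm)
      rw [add_zero]
      simp only [G]
      rw [← Equiv.sum_comp (Equiv.mulRight (Units.mk0 _ ht')) fun s : Fˣ =>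
        lam F r (s + a * (s : F)⁻¹ * (p t)⁻¹)]
      refine Finset.sum_congr rfl fun u _ => congrArg _ ?_
      have hpt : p t = t * ((1 + t : F)⁻¹) ^ 2 := by
        simp only [p]
        field_simp
        linear_combination CharTwo.two_eq_zero (R := F)
      rw [hpt]
      simp only [Equiv.coe_mulRight, Units.val_mul, Units.val_mk0]
      field_simp
      ring
  have hK : Kl F r a ^ 2 = ∑ t : Fˣ, (G (p t) + if t = 1 then 2 ^ r else 0) := by
    rw [sq, Kl_eq_sum_units, Finset.sum_mul_sum]
    simp only [← hterm]
    rw [Finset.sum_comm (s := (Finset.univ : Finset Fˣ)) (f := fun t u : Fˣ =>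
      lam F r ((u : F) * (1 + t) + a * (u : F)⁻¹ * (1 + (t : F)⁻¹)))]
    refine Finset.sum_congr rfl fun u _ => ?_
    rw [← Equiv.sum_comp (Equiv.mulLeft u)]
    refine Finset.sum_congr rfl fun t _ => ?_
    rw [← lam_add hF]
    congr 1
    simp only [Equiv.coe_mulLeft, Units.val_mul, mul_inv]
    ring
  have hK2 : ∑ c : Fˣ, lam F r c * G c = Klm F r 2 a := by
    rw [Klm_two_eq_sum_units]
    refine Finset.sum_congr rfl fun c _ => ?_
    simp only [G, Finset.mul_sum, ← lam_add hF]
    refine Finset.sum_congr rfl fun s _ => congrArg _ ?_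
    rw [mul_inv]
    ring
  have hG : ∑ c : Fˣ, G c = 1 := by
    simp only [G]
    rw [Finset.sum_comm]
    have h : ∀ s : Fˣ, ∑ c : Fˣ, lam F r (s + a * (s : F)⁻¹ * (c : F)⁻¹) = -lam F r s := by
      intro s
      simp only [lam_add hF]
      rw [← Finset.mul_sum, ← mul_neg_one]
      congr 1
      rw [← sum_units_lam_mul hr hF (b := a * (s : F)⁻¹) (by simp [ha]),
        ← Equiv.sum_comp (Equiv.inv Fˣ)]
      simp
    simp only [h, Finset.sum_neg_distrib]
    have h' := sum_units_lam_mul hr hF (one_ne_zero (α := F))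
    simp only [one_mul] at h'
    rw [h', neg_neg]
  have e1 := sum_eq_add_sum_units fun t => G (p t)
  have e2 := sum_eq_add_sum_units fun c => (1 + lam F r c) * G c
  simp only [add_mul, one_mul, Finset.sum_add_distrib, lam_zero, hK2, hG, hp0, hG0] at e1 e2 hsum
  rw [hK, Finset.sum_add_distrib, Finset.sum_ite_eq' Finset.univ, if_pos (Finset.mem_univ _)]
  linarith

end KloostermanSums

theorem sum_matrix_two {F : Type} [Fintype F] (g : Matrix (Fin 2) (Fin 2) F → ℤ) :
    ∑ A, g A = ∑ x : F, ∑ w : F, ∑ y : F, ∑ z : F, g !![x, y; z, w] := by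
  simp only [← Fintype.sum_prod_type']
  symm
  refine Fintype.sum_equiv
    { toFun := fun p : F × F × F × F => !![p.1, p.2.2.1; p.2.2.2, p.2.1]
      invFun := fun A => (A 0 0, A 1 1, A 0 1, A 1 0)
      left_inv := fun p => by simp
      right_inv := fun A => (Matrix.eta_fin_two A).symm } _ _ fun p => rfl

section SpecialLinearTraceSums

variable {F : Type} [Field F] [Fintype F] [DecidableEq F] {r : ℕ}

variable (F) in
/-- The matrices of determinant one of size two. -/
def detOne : Finset (Matrix (Fin 2) (Fin 2) F) := Finset.univ.filter fun A => A.det = 1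

theorem mem_detOne {A : Matrix (Fin 2) (Fin 2) F} : A ∈ detOne F ↔ A.det = 1 := by
  simp [detOne]

theorem sum_ite_mul_eq (c : F) :
    ∑ y : F, ∑ z : F, (if y * z = c then (1 : ℤ) else 0) =
      (Fintype.card F - 1) + if c = 0 then (Fintype.card F : ℤ) else 0 := by
  have h : ∀ y : Fˣ, ∑ z : F, (if (y : F) * z = c then (1 : ℤ) else 0) = 1 := by
    intro y
    rw [← Equiv.sum_comp (Equiv.mulLeft₀ (y : F) y.ne_zero).symm]
    simp
  rw [sum_eq_add_sum_units, Finset.sum_congr rfl fun y _ => h y]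
  simp only [zero_mul, Finset.sum_const, Finset.card_univ, Fintype.card_units, nsmul_eq_mul,
    eq_comm (a := (0 : F))]
  rw [Nat.cast_sub Fintype.card_pos]
  split_ifs <;> push_cast <;> ring

theorem sum_detOne_trace (f : F → ℤ) :
    ∑ A ∈ detOne F, f A.trace =
      Fintype.card F * (Fintype.card F - 1) * ∑ t, f t +
        Fintype.card F * ∑ u : Fˣ, f (u + (u : F)⁻¹) := by
  have h1 : ∀ x w : F, ∑ y : F, ∑ z : F, (if !![x, y; z, w].det = 1 then f !![x, y; z, w].trace
      else 0) = f (x + w) * (Fintype.card F - 1) +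
        if w * x = 1 then f (x + w) * Fintype.card F else 0 := by
    intro x w
    have h := sum_ite_mul_eq (x * w - 1)
    have e : ∀ y z : F, (x * w - y * z = 1) = (y * z = x * w - 1) := fun y z =>
      propext ⟨fun h => by linear_combination -h, fun h => by linear_combination -h⟩
    simp only [Matrix.det_fin_two_of, Matrix.trace_fin_two_of, e]
    calc _ = f (x + w) * ∑ y : F, ∑ z : F, (if y * z = x * w - 1 then (1 : ℤ) else 0) := by
          simp only [Finset.mul_sum, mul_ite, mul_one, mul_zero]
      _ = _ := by
          rw [h, mul_add]
          simp only [sub_eq_zero, mul_ite, mul_zero, mul_comm x w]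
  have h2 : ∀ x : F, ∑ w : F, f (x + w) = ∑ t, f t := fun x => Equiv.sum_comp (Equiv.addLeft x) f
  have h3 : ∀ x : Fˣ, ∑ w : F, (if w * x = 1 then f (x + w) * (Fintype.card F : ℤ) else 0) =
      Fintype.card F * f (x + (x : F)⁻¹) := by
    intro x
    simp only [mul_eq_one_iff_eq_inv₀ x.ne_zero]
    rw [Finset.sum_ite_eq' Finset.univ, if_pos (Finset.mem_univ _), mul_comm]
  rw [detOne, Finset.sum_filter, sum_matrix_two]
  simp only [h1, Finset.sum_add_distrib]
  congr 1
  · simp only [← Finset.sum_mul, h2, Finset.sum_const, Finset.card_univ, nsmul_eq_mul]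
    ring
  · rw [sum_eq_add_sum_units, Finset.mul_sum, Finset.sum_congr rfl fun x _ => h3 x]
    simp

theorem sum_detOne_sum_detOne_lam [CharP F 2] (hr : 1 ≤ r) (hF : Fintype.card F = 2 ^ r) {a : F}
    (ha : a ≠ 0) :
    ∑ A ∈ detOne F, ∑ C ∈ detOne F, lam F r (a * (A.trace * C.trace)) =
      (2 ^ r : ℤ) ^ 2 * (Kl F r a ^ 2 + (2 ^ r : ℤ) ^ 3 - 2 ^ r) := by
  have hq : (Fintype.card F : ℤ) = 2 ^ r := by rw [hF]; push_cast; rfl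
  have hu : ∀ u : Fˣ, a * ((u : F) + (u : F)⁻¹) = 0 ↔ u = 1 := by
    intro u
    rw [mul_eq_zero, CharTwo.add_eq_zero, or_iff_right ha]
    constructor
    · intro h
      have h' : (u : F) ^ 2 = 1 := by
        rw [sq]
        nth_rewrite 2 [h]
        exact mul_inv_cancel₀ u.ne_zero
      exact Units.ext (by simpa using CharTwo.sq_injective (h'.trans (one_pow 2).symm))
    · rintro rfl
      simp
  have h1 : ∀ s : F, ∑ C ∈ detOne F, lam F r (a * (s * C.trace)) =
      2 ^ r * (2 ^ r - 1) * (if s = 0 then 2 ^ r else 0) +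
        2 ^ r * ∑ u : Fˣ, lam F r (a * (u + (u : F)⁻¹) * s) := by
    intro s
    rw [sum_detOne_trace fun t => lam F r (a * (s * t)), hq]
    simp only [← mul_assoc, sum_lam_mul hr hF]
    simp only [mul_eq_zero, or_iff_right ha, mul_right_comm a s]
  simp only [h1]
  rw [sum_detOne_trace fun s => 2 ^ r * (2 ^ r - 1) * (if s = 0 then 2 ^ r else 0) +
        2 ^ r * ∑ u : Fˣ, lam F r (a * (u + (u : F)⁻¹) * s)]
  simp only [Finset.sum_add_distrib, ← Finset.mul_sum]
  rw [sum_units_lam_mul_add_inv_mul_add_inv hF ha, Finset.sum_comm]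
  simp only [sum_lam_mul hr hF, hu, hq]
  have hu' : ∀ u : Fˣ, (u : F) + (u : F)⁻¹ = 0 ↔ u = 1 := fun u => by
    rw [← hu u, mul_eq_zero, or_iff_right ha]
  simp only [hu', Finset.sum_ite_eq', Finset.mem_univ, if_true]
  ring

end SpecialLinearTraceSums

section DicksonInvariant

variable {F : Type} [Field F] {n : ℕ}

/-- The matrix of the bilinear form `∑ i, x_i y_{n+i}`. -/
def polarHalf (F : Type) [Field F] (n : ℕ) : Matrix (Fin n ⊕ Fin n) (Fin n ⊕ Fin n) F :=
  Matrix.fromBlocks 0 1 0 0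

/-- The matrix `w` preserves the quadratic form `θ⁺`. -/
def PreservesTheta (w : Matrix (Fin n ⊕ Fin n) (Fin n ⊕ Fin n) F) : Prop :=
  ∀ x, thetaPlus F n (w.mulVec x) = thetaPlus F n x

/-- The invariant `δ⁺(w) = Tr(B ᵗC)`. -/
def dickson (w : Matrix (Fin n ⊕ Fin n) (Fin n ⊕ Fin n) F) : F :=
  Matrix.trace (Matrix.toBlocks₁₂ w * (Matrix.toBlocks₂₁ w)ᵀ)

theorem thetaPlus_eq_dotProduct (x : Fin n ⊕ Fin n → F) :
    thetaPlus F n x = x ⬝ᵥ (polarHalf F n *ᵥ x) := by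
  simp [thetaPlus, polarHalf, Matrix.fromBlocks_mulVec, dotProduct]

theorem dickson_eq_trace (w : Matrix (Fin n ⊕ Fin n) (Fin n ⊕ Fin n) F) :
    dickson w = (wᵀ * polarHalf F n * w * polarHalf F n).trace := by
  have htr : ∀ A B C D : Matrix (Fin n) (Fin n) F,
      (Matrix.fromBlocks A B C D).trace = A.trace + D.trace := fun A B C D => by
    simp [Matrix.trace, Fintype.sum_sum_type]
  conv_rhs => rw [← Matrix.fromBlocks_toBlocks w]
  simp only [dickson, polarHalf, Matrix.fromBlocks_transpose, Matrix.fromBlocks_multiply, htr,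
    mul_zero, mul_one, zero_add, add_zero, zero_mul, Matrix.trace_zero]
  rw [← Matrix.trace_transpose, Matrix.transpose_mul, Matrix.transpose_transpose,
    Matrix.trace_mul_comm]

theorem PreservesTheta.alternating {w : Matrix (Fin n ⊕ Fin n) (Fin n ⊕ Fin n) F}
    (hw : PreservesTheta w) (x : Fin n ⊕ Fin n → F) :
    x ⬝ᵥ ((wᵀ * polarHalf F n * w - polarHalf F n) *ᵥ x) = 0 := by
  have h := hw x
  rw [thetaPlus_eq_dotProduct, thetaPlus_eq_dotProduct] at h
  rw [Matrix.sub_mulVec, dotProduct_sub, ← h, ← Matrix.mulVec_mulVec, ← Matrix.mulVec_mulVec,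
    Matrix.dotProduct_mulVec _ wᵀ, Matrix.vecMul_transpose, sub_self]

theorem PreservesTheta.mul {g w : Matrix (Fin n ⊕ Fin n) (Fin n ⊕ Fin n) F}
    (hg : PreservesTheta g) (hw : PreservesTheta w) : PreservesTheta (g * w) := fun x => by
  rw [← Matrix.mulVec_mulVec, hg, hw]

theorem diag_eq_zero_of_alternating {ι : Type} [Fintype ι] [DecidableEq ι] {S : Matrix ι ι F}
    (hS : ∀ x, x ⬝ᵥ (S *ᵥ x) = 0) (i : ι) : S i i = 0 := by
  simpa using hS (Pi.single i 1)

theorem transpose_eq_neg_of_alternating {ι : Type} [Fintype ι] [DecidableEq ι]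
    {S : Matrix ι ι F} (hS : ∀ x, x ⬝ᵥ (S *ᵥ x) = 0) : Sᵀ = -S := by
  ext i j
  have h := hS (Pi.single i 1 + Pi.single j 1)
  have hi := hS (Pi.single i 1)
  have hj := hS (Pi.single j 1)
  simp [Matrix.mulVec_add, add_dotProduct] at h hi hj
  simp only [Matrix.transpose_apply, Matrix.neg_apply]
  linear_combination h - hi - hj

theorem trace_mul_eq_zero_of_alternating [CharP F 2] {ι : Type} [Fintype ι] [DecidableEq ι]
    {S T : Matrix ι ι F} (hS : ∀ x, x ⬝ᵥ (S *ᵥ x) = 0) (hT : Tᵀ = T) : (S * T).trace = 0 := by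
  have hs : ∀ i j, S j i = S i j := fun i j => by
    have h := congrFun (congrFun (transpose_eq_neg_of_alternating hS) i) j
    rwa [Matrix.neg_apply, CharTwo.neg_eq] at h
  have ht : ∀ i j, T j i = T i j := fun i j => congrFun (congrFun hT i) j
  simp only [Matrix.trace, Matrix.diag, Matrix.mul_apply, ← Fintype.sum_prod_type']
  refine Finset.sum_involution (fun p _ => p.swap) ?_ ?_ ?_ ?_
  · intro p _
    simp only [Prod.fst_swap, Prod.snd_swap]
    rw [hs, ht, CharTwo.add_self_eq_zero]
  · rintro ⟨i, j⟩ _ hne h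
    obtain rfl : j = i := congrArg Prod.fst h
    exact hne (by simp [diag_eq_zero_of_alternating hS])
  · simp
  · simp

theorem PreservesTheta.transpose_mul_mul [CharP F 2]
    {w : Matrix (Fin n ⊕ Fin n) (Fin n ⊕ Fin n) F} (hw : PreservesTheta w) :
    wᵀ * (polarHalf F n + (polarHalf F n)ᵀ) * w = polarHalf F n + (polarHalf F n)ᵀ := by
  have h := transpose_eq_neg_of_alternating hw.alternating
  simp only [Matrix.transpose_sub, Matrix.transpose_mul, Matrix.transpose_transpose] at h
  rw [mul_add, add_mul]
  rw [← mul_assoc] at h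
  have h' := sub_eq_iff_eq_add.1 h
  rw [h']
  abel

theorem polarHalf_add_transpose_mul_self :
    (polarHalf F n + (polarHalf F n)ᵀ) * (polarHalf F n + (polarHalf F n)ᵀ) = 1 := by
  simp [polarHalf, Matrix.fromBlocks_transpose, Matrix.fromBlocks_add, Matrix.fromBlocks_multiply]

theorem PreservesTheta.mul_mul_transpose [CharP F 2]
    {w : Matrix (Fin n ⊕ Fin n) (Fin n ⊕ Fin n) F} (hw : PreservesTheta w) :
    w * (polarHalf F n + (polarHalf F n)ᵀ) * wᵀ = polarHalf F n + (polarHalf F n)ᵀ := by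
  set J := polarHalf F n + (polarHalf F n)ᵀ with hJ
  have hJJ : J * J = 1 := polarHalf_add_transpose_mul_self
  have h : wᵀ * J * w = J := hw.transpose_mul_mul
  have h1 : (J * wᵀ * J) * w = 1 := by
    rw [mul_assoc J, mul_assoc J, h, hJJ]
  have h2 : w * (J * wᵀ * J) = 1 := mul_eq_one_comm.1 h1
  calc w * J * wᵀ = w * (J * wᵀ * J) * J := by
        simp only [mul_assoc, hJJ, mul_one]
    _ = J := by rw [h2, one_mul]

theorem dickson_mul [CharP F 2] {g w : Matrix (Fin n ⊕ Fin n) (Fin n ⊕ Fin n) F}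
    (hg : PreservesTheta g) (hw : PreservesTheta w) :
    dickson (g * w) = dickson g + dickson w := by
  set M := polarHalf F n with hM
  have hMM : M * M = 0 := by simp [hM, polarHalf, Matrix.fromBlocks_multiply]
  have hsymm : (w * M * wᵀ - M)ᵀ = w * M * wᵀ - M := by
    have h := hw.mul_mul_transpose
    rw [← hM, mul_add, add_mul] at h
    simp only [Matrix.transpose_sub, Matrix.transpose_mul, Matrix.transpose_transpose]
    rw [← mul_assoc, eq_sub_of_add_eq' h]
    ext i j
    simp only [Matrix.sub_apply, Matrix.add_apply, CharTwo.sub_eq_add]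
    linear_combination Mᵀ i j * CharTwo.two_eq_zero (R := F)
  have h := trace_mul_eq_zero_of_alternating hg.alternating hsymm
  rw [← hM, mul_sub, sub_mul, sub_mul, hMM, sub_zero] at h
  have e1 : dickson (g * w) = (gᵀ * M * g * (w * M * wᵀ)).trace := by
    rw [dickson_eq_trace, Matrix.transpose_mul, ← hM]
    rw [show wᵀ * gᵀ * M * (g * w) * M = wᵀ * (gᵀ * M * g * (w * M)) by simp only [mul_assoc],
      Matrix.trace_mul_comm]
    simp only [mul_assoc]
  have e2 : dickson w = (M * (w * M * wᵀ)).trace := by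
    rw [dickson_eq_trace, ← hM, show wᵀ * M * w * M = wᵀ * (M * (w * M)) by simp only [mul_assoc],
      Matrix.trace_mul_comm]
    simp only [mul_assoc]
  rw [e1, e2, dickson_eq_trace, ← hM]
  simp only [Matrix.trace_sub] at h
  linear_combination h

end DicksonInvariant

section TensorAction

variable {F : Type} [Field F]

/-- The coordinates of `F ^ 4` arranged as the entries of a square matrix of size two, so that
`θ⁺` becomes the determinant up to sign. -/
def coordEquiv : Fin 2 ⊕ Fin 2 ≃ Fin 2 × Fin 2 where
  toFun := Sum.elim ![(0, 0), (0, 1)] ![(1, 1), (1, 0)]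
  invFun p := !![Sum.inl 0, Sum.inl 1; Sum.inr 1, Sum.inr 0] p.1 p.2
  left_inv := by decide
  right_inv := by decide

@[simp] theorem coordEquiv_inl_zero : coordEquiv (Sum.inl 0) = (0, 0) := rfl
@[simp] theorem coordEquiv_inl_one : coordEquiv (Sum.inl 1) = (0, 1) := rfl
@[simp] theorem coordEquiv_inr_zero : coordEquiv (Sum.inr 0) = (1, 1) := rfl
@[simp] theorem coordEquiv_inr_one : coordEquiv (Sum.inr 1) = (1, 0) := rfl

/-- The matrix of `X ↦ A X ᵗC` in the coordinates `coordEquiv`. -/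
def tensorAction (A C : Matrix (Fin 2) (Fin 2) F) : Matrix (Fin 2 ⊕ Fin 2) (Fin 2 ⊕ Fin 2) F :=
  (Matrix.kroneckerMap (· * ·) A C).submatrix coordEquiv coordEquiv

theorem tensorAction_apply (A C : Matrix (Fin 2) (Fin 2) F) (s t : Fin 2 ⊕ Fin 2) :
    tensorAction A C s t = A (coordEquiv s).1 (coordEquiv t).1 *
      C (coordEquiv s).2 (coordEquiv t).2 := rfl

theorem tensorAction_mul (A A' C C' : Matrix (Fin 2) (Fin 2) F) :
    tensorAction A C * tensorAction A' C' = tensorAction (A * A') (C * C') := by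
  rw [tensorAction, tensorAction, Matrix.submatrix_mul_equiv, ← Matrix.mul_kronecker_mul]
  rfl

theorem tensorAction_one : tensorAction (1 : Matrix (Fin 2) (Fin 2) F) 1 = 1 := by
  rw [tensorAction, Matrix.one_kronecker_one, Matrix.submatrix_one_equiv]

theorem trace_tensorAction (A C : Matrix (Fin 2) (Fin 2) F) :
    (tensorAction A C).trace = A.trace * C.trace := by
  rw [← Matrix.trace_kronecker]
  exact Equiv.sum_comp coordEquiv fun p => Matrix.kroneckerMap (· * ·) A C p p

theorem tensorAction_adjugate_mul {A C : Matrix (Fin 2) (Fin 2) F} (hA : A.det = 1)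
    (hC : C.det = 1) : tensorAction A.adjugate C.adjugate * tensorAction A C = 1 := by
  rw [tensorAction_mul, Matrix.adjugate_mul, Matrix.adjugate_mul, hA, hC, one_smul, tensorAction_one]

theorem det_adjugate_fin_two (A : Matrix (Fin 2) (Fin 2) F) : A.adjugate.det = A.det := by
  rw [Matrix.det_adjugate]
  simp

theorem tensorAction_mulVec (A C : Matrix (Fin 2) (Fin 2) F) (u v : Fin 2 → F) :
    tensorAction A C *ᵥ (fun s => u (coordEquiv s).1 * v (coordEquiv s).2) =
      fun s => (A *ᵥ u) (coordEquiv s).1 * (C *ᵥ v) (coordEquiv s).2 := by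
  funext s
  simp only [Matrix.mulVec, dotProduct, tensorAction_apply, Fintype.sum_sum_type,
    Fin.sum_univ_two, coordEquiv_inl_zero, coordEquiv_inl_one, coordEquiv_inr_zero,
    coordEquiv_inr_one]
  ring

theorem preservesTheta_tensorAction [CharP F 2] {A C : Matrix (Fin 2) (Fin 2) F}
    (hA : A.det = 1) (hC : C.det = 1) : PreservesTheta (tensorAction A C) := by
  intro x
  have h2 := CharTwo.two_eq_zero (R := F)
  rw [Matrix.det_fin_two] at hA hC
  simp only [thetaPlus, Matrix.mulVec, dotProduct, tensorAction_apply, Fintype.sum_sum_type,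
    Fin.sum_univ_two, coordEquiv_inl_zero, coordEquiv_inl_one, coordEquiv_inr_zero,
    coordEquiv_inr_one]
  generalize x (Sum.inl 0) = x0
  generalize x (Sum.inl 1) = x1
  generalize x (Sum.inr 0) = x2
  generalize x (Sum.inr 1) = x3
  generalize A 0 0 = a at *
  generalize A 0 1 = b at *
  generalize A 1 0 = c at *
  generalize A 1 1 = d at *
  generalize C 0 0 = a' at *
  generalize C 0 1 = b' at *
  generalize C 1 0 = c' at *
  generalize C 1 1 = d' at *
  linear_combination ((a * c' * x0 + a * d' * x1 + (b * d' * x2 + b * c' * x3)) *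
      (c * a' * x0 + c * b' * x1 + (d * b' * x2 + d * a' * x3)) - x1 * x3) * h2 +
      (x0 * x2 - x1 * x3) * (a' * d' - b' * c') * hA + (x0 * x2 - x1 * x3) * hC

theorem dickson_tensorAction [CharP F 2] (A C : Matrix (Fin 2) (Fin 2) F) :
    dickson (tensorAction A C) = 0 := by
  simp only [dickson, Matrix.trace, Matrix.diag_apply, Matrix.mul_apply, Matrix.transpose_apply,
    Matrix.toBlocks₁₂, Matrix.toBlocks₂₁, Matrix.of_apply, Fin.sum_univ_two, tensorAction_apply,
    coordEquiv_inl_zero, coordEquiv_inl_one, coordEquiv_inr_zero, coordEquiv_inr_one]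
  linear_combination (A 0 1 * A 1 0 * (C 0 1 * C 1 0 + C 0 0 * C 1 1)) *
    CharTwo.two_eq_zero (R := F)

theorem eq_of_mul_eq_mul_of_det_eq_one [CharP F 2] {A A' C C' : Matrix (Fin 2) (Fin 2) F}
    (hA : A.det = 1) (hA' : A'.det = 1) (hC' : C'.det = 1)
    (h : ∀ i j k l, A i j * C k l = A' i j * C' k l) : A = A' := by
  rw [Matrix.det_fin_two] at hA hA' hC'
  set m := C 0 0 * C' 1 1 - C 0 1 * C' 1 0 with hm
  have h1 : ∀ i j, A i j * m = A' i j := fun i j => by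
    linear_combination A' i j * hC' + C' 1 1 * h i j 0 0 - C' 1 0 * h i j 0 1
  have hm1 : m = 1 := by
    refine CharTwo.sq_injective (show m ^ 2 = 1 ^ 2 from ?_)
    rw [← h1, ← h1, ← h1, ← h1] at hA'
    linear_combination hA' - m ^ 2 * hA
  ext i j
  rw [← h1, hm1, mul_one]

theorem tensorAction_injective [CharP F 2] {A A' C C' : Matrix (Fin 2) (Fin 2) F}
    (hA : A.det = 1) (hA' : A'.det = 1) (hC : C.det = 1) (hC' : C'.det = 1)
    (h : tensorAction A C = tensorAction A' C') : A = A' ∧ C = C' := by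
  have h' : ∀ i j k l, A i j * C k l = A' i j * C' k l := fun i j k l => by
    simpa [tensorAction_apply] using
      congrFun (congrFun h (coordEquiv.symm (i, k))) (coordEquiv.symm (j, l))
  exact ⟨eq_of_mul_eq_mul_of_det_eq_one hA hA' hC' h',
    eq_of_mul_eq_mul_of_det_eq_one hC hC' hA' fun i j k l => by
      rw [mul_comm (C i j), mul_comm (C' i j)]
      exact h' k l i j⟩

theorem exists_det_eq_one_mulVec_eq {u : Fin 2 → F} (hu : u ≠ 0) :
    ∃ A : Matrix (Fin 2) (Fin 2) F, A.det = 1 ∧ A *ᵥ u = ![1, 0] := by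
  by_cases h : u 0 = 0
  · have h1 : u 1 ≠ 0 := fun h1 => hu (by ext i; fin_cases i <;> simp [h, h1])
    refine ⟨!![0, (u 1)⁻¹; -u 1, 0], by simp [h1], ?_⟩
    ext i
    fin_cases i <;> simp [Matrix.mulVec, dotProduct, h, h1]
  · refine ⟨!![(u 0)⁻¹, 0; -u 1, u 0], by simp [h], ?_⟩
    ext i
    fin_cases i <;> simp [Matrix.mulVec, dotProduct, h]
    ring

theorem exists_eq_mul_of_thetaPlus_eq_zero [CharP F 2] {x : Fin 2 ⊕ Fin 2 → F} (hx : x ≠ 0)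
    (h : thetaPlus F 2 x = 0) : ∃ u v : Fin 2 → F, u ≠ 0 ∧ v ≠ 0 ∧
      x = fun s => u (coordEquiv s).1 * v (coordEquiv s).2 := by
  have h2 := CharTwo.two_eq_zero (R := F)
  simp only [thetaPlus, Fin.sum_univ_two] at h
  by_cases h0 : x (Sum.inl 0) = 0
  · by_cases h1 : x (Sum.inl 1) = 0
    · refine ⟨![0, 1], ![x (Sum.inr 1), x (Sum.inr 0)], fun h => by simpa using congrFun h 1,
        fun hv => hx ?_, ?_⟩
      · have e0 := congrFun hv 0
        have e1 := congrFun hv 1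
        simp only [Matrix.cons_val_zero, Matrix.cons_val_one, Pi.zero_apply] at e0 e1
        ext (i | i) <;> fin_cases i <;> simp [h0, h1, e0, e1]
      · ext (i | i) <;> fin_cases i <;> simp [h0, h1]
    · refine ⟨![1, x (Sum.inr 0) / x (Sum.inl 1)], ![x (Sum.inl 0), x (Sum.inl 1)],
        fun h => by simpa using congrFun h 0, fun hv => h1 (by simpa using congrFun hv 1), ?_⟩
      ext (i | i) <;> fin_cases i <;> simp [h1, h0]
      simpa [h0, h1] using h
  · refine ⟨![1, x (Sum.inr 1) / x (Sum.inl 0)], ![x (Sum.inl 0), x (Sum.inl 1)],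
      fun h => by simpa using congrFun h 0, fun hv => h0 (by simpa using congrFun hv 0), ?_⟩
    ext (i | i) <;> fin_cases i <;> simp [h0]
    field_simp
    linear_combination h - x (Sum.inl 1) * x (Sum.inr 1) * h2

/-- The matrix `w` is the action of a pair of matrices of determinant one. -/
def IsTensorAction (w : Matrix (Fin 2 ⊕ Fin 2) (Fin 2 ⊕ Fin 2) F) : Prop :=
  ∃ A C : Matrix (Fin 2) (Fin 2) F, A.det = 1 ∧ C.det = 1 ∧ w = tensorAction A C

theorem IsTensorAction.of_tensorAction_mul {A C : Matrix (Fin 2) (Fin 2) F}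
    {w : Matrix (Fin 2 ⊕ Fin 2) (Fin 2 ⊕ Fin 2) F} (hA : A.det = 1) (hC : C.det = 1)
    (h : IsTensorAction (tensorAction A C * w)) : IsTensorAction w := by
  obtain ⟨A', C', hA', hC', h⟩ := h
  refine ⟨A.adjugate * A', C.adjugate * C', ?_, ?_, ?_⟩
  · rw [Matrix.det_mul, det_adjugate_fin_two, hA, hA', one_mul]
  · rw [Matrix.det_mul, det_adjugate_fin_two, hC, hC', one_mul]
  · rw [← tensorAction_mul, ← h, ← mul_assoc, tensorAction_adjugate_mul hA hC, one_mul]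

theorem PreservesTheta.polar_apply [CharP F 2]
    {w : Matrix (Fin 2 ⊕ Fin 2) (Fin 2 ⊕ Fin 2) F} (hw : PreservesTheta w) (s t : Fin 2 ⊕ Fin 2) :
    w (Sum.inl 0) s * w (Sum.inr 0) t + w (Sum.inr 0) s * w (Sum.inl 0) t +
      (w (Sum.inl 1) s * w (Sum.inr 1) t + w (Sum.inr 1) s * w (Sum.inl 1) t) =
      (polarHalf F 2 + (polarHalf F 2)ᵀ) s t := by
  rw [← hw.transpose_mul_mul]
  simp [Matrix.mul_apply, polarHalf, Fintype.sum_sum_type, Fin.sum_univ_two]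
  ring

theorem PreservesTheta.thetaPlus_col {w : Matrix (Fin 2 ⊕ Fin 2) (Fin 2 ⊕ Fin 2) F}
    (hw : PreservesTheta w) (t : Fin 2 ⊕ Fin 2) :
    w (Sum.inl 0) t * w (Sum.inr 0) t + w (Sum.inl 1) t * w (Sum.inr 1) t = 0 := by
  have h := hw (Pi.single t 1)
  rw [Matrix.mulVec_single_one] at h
  simp only [thetaPlus, Fin.sum_univ_two, Matrix.col_apply] at h
  rw [h]
  rcases t with t | t <;> simp

theorem PreservesTheta.isTensorAction_of_mulVec_single_eq [Finite F] [CharP F 2]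
    {w : Matrix (Fin 2 ⊕ Fin 2) (Fin 2 ⊕ Fin 2) F} (hw : PreservesTheta w) (hδ : dickson w = 0)
    (h0 : w *ᵥ Pi.single (Sum.inl 0) 1 = Pi.single (Sum.inl 0) 1)
    (h2 : w *ᵥ Pi.single (Sum.inr 0) 1 = Pi.single (Sum.inr 0) 1) : IsTensorAction w := by
  rw [Matrix.mulVec_single_one] at h0 h2
  have c0 : ∀ s, w s (Sum.inl 0) = Pi.single (M := fun _ => F) (Sum.inl 0) 1 s := congrFun h0
  have c2 : ∀ s, w s (Sum.inr 0) = Pi.single (M := fun _ => F) (Sum.inr 0) 1 s := congrFun h2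
  have p01 := hw.polar_apply (Sum.inl 0) (Sum.inl 1)
  have p03 := hw.polar_apply (Sum.inl 0) (Sum.inr 1)
  have p21 := hw.polar_apply (Sum.inr 0) (Sum.inl 1)
  have p23 := hw.polar_apply (Sum.inr 0) (Sum.inr 1)
  have p13 := hw.polar_apply (Sum.inl 1) (Sum.inr 1)
  have t1 := hw.thetaPlus_col (Sum.inl 1)
  have t3 := hw.thetaPlus_col (Sum.inr 1)
  simp [c0, c2, polarHalf] at p01 p03 p21 p23 p13 t1 t3
  simp [p01, p03, p21, p23] at p13 t1 t3
  simp [dickson, Matrix.trace, Matrix.mul_apply, Matrix.toBlocks₁₂, Matrix.toBlocks₂₁,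
    Fin.sum_univ_two, c0, c2, p01] at hδ
  have hPS : w (Sum.inl 1) (Sum.inl 1) * w (Sum.inr 1) (Sum.inr 1) = 1 := by
    rcases hδ with h | h <;> simpa [h] using p13
  have hP : w (Sum.inl 1) (Sum.inl 1) ≠ 0 := left_ne_zero_of_mul_eq_one hPS
  have hS : w (Sum.inr 1) (Sum.inr 1) ≠ 0 := right_ne_zero_of_mul_eq_one hPS
  have hR : w (Sum.inr 1) (Sum.inl 1) = 0 := t1.resolve_left hP
  have hQ : w (Sum.inl 1) (Sum.inr 1) = 0 := t3.resolve_right hS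
  obtain ⟨d, hd⟩ := FiniteField.isSquare_of_char_two (ringChar.eq F 2)
    (w (Sum.inl 1) (Sum.inl 1))
  have hd0 : d ≠ 0 := by
    rintro rfl
    exact hP (by simpa using hd)
  have hS' : w (Sum.inr 1) (Sum.inr 1) = d⁻¹ * d⁻¹ := by
    rw [← mul_inv, ← hd]
    exact eq_inv_of_mul_eq_one_right hPS
  refine ⟨!![d, 0; 0, d⁻¹], !![d⁻¹, 0; 0, d], by simp [hd0], by simp [hd0], ?_⟩
  ext (i | i) (j | j) <;> fin_cases i <;> fin_cases j <;>
    simp [tensorAction_apply, c0, c2, p01, p03, p21, p23, hR, hQ, hd, hS', hd0]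

theorem PreservesTheta.isTensorAction [Finite F] [CharP F 2]
    {w : Matrix (Fin 2 ⊕ Fin 2) (Fin 2 ⊕ Fin 2) F} (hw : PreservesTheta w)
    (hδ : dickson w = 0) (hunit : IsUnit w) : IsTensorAction w := by
  obtain ⟨u, v, hu, hv, hx⟩ := exists_eq_mul_of_thetaPlus_eq_zero
    (x := w *ᵥ Pi.single (Sum.inl 0) 1)
    (fun h => by
      have h' := Matrix.mulVec_injective_of_isUnit hunit (h.trans (Matrix.mulVec_zero w).symm)
      simpa using congrFun h' (Sum.inl 0))
    (by rw [hw]; simp [thetaPlus])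
  obtain ⟨A, hA, hAu⟩ := exists_det_eq_one_mulVec_eq hu
  obtain ⟨C, hC, hCv⟩ := exists_det_eq_one_mulVec_eq hv
  apply IsTensorAction.of_tensorAction_mul hA hC
  have hφ := preservesTheta_tensorAction hA hC
  have hδ1 : dickson (tensorAction A C * w) = 0 := by
    rw [dickson_mul hφ hw, dickson_tensorAction, hδ, add_zero]
  have hw1 := hφ.mul hw
  have hx1 : (tensorAction A C * w) *ᵥ Pi.single (Sum.inl 0) 1 = Pi.single (Sum.inl 0) 1 := by
    rw [← Matrix.mulVec_mulVec, hx, tensorAction_mulVec, hAu, hCv]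
    ext (i | i) <;> fin_cases i <;> simp
  generalize tensorAction A C * w = w' at *
  have c0 : ∀ s, w' s (Sum.inl 0) = Pi.single (M := fun _ => F) (Sum.inl 0) 1 s :=
    congrFun (by rwa [Matrix.mulVec_single_one] at hx1)
  have p02 := hw1.polar_apply (Sum.inl 0) (Sum.inr 0)
  have t2 := hw1.thetaPlus_col (Sum.inr 0)
  simp [c0, polarHalf] at p02
  rw [p02, mul_one, CharTwo.add_eq_zero] at t2
  have hA' : (!![1, -w' (Sum.inl 1) (Sum.inr 0); 0, 1] : Matrix (Fin 2) (Fin 2) F).det = 1 := by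
    simp
  have hC' : (!![1, -w' (Sum.inr 1) (Sum.inr 0); 0, 1] : Matrix (Fin 2) (Fin 2) F).det = 1 := by
    simp
  have hφ' := preservesTheta_tensorAction hA' hC'
  apply IsTensorAction.of_tensorAction_mul hA' hC'
  refine (hφ'.mul hw1).isTensorAction_of_mulVec_single_eq ?_ ?_ ?_
  · rw [dickson_mul hφ' hw1, dickson_tensorAction, hδ1, add_zero]
  · rw [← Matrix.mulVec_mulVec, hx1, Matrix.mulVec_single_one]
    ext (i | i) <;> fin_cases i <;> simp [tensorAction_apply]
  · have hy : w' *ᵥ Pi.single (Sum.inr 0) 1 = fun s =>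
        ![w' (Sum.inl 1) (Sum.inr 0), 1] (coordEquiv s).1 *
          ![w' (Sum.inr 1) (Sum.inr 0), 1] (coordEquiv s).2 := by
      rw [Matrix.mulVec_single_one]
      ext (i | i) <;> fin_cases i <;> simp [t2, p02]
    rw [← Matrix.mulVec_mulVec, hy, tensorAction_mulVec]
    ext (i | i) <;> fin_cases i <;> simp [Matrix.mulVec, dotProduct]

end TensorAction

theorem mem_SOplusGrp_two {F : Type} [Field F] [Fintype F] [DecidableEq F] [CharP F 2]
    {w : Matrix (Fin 2 ⊕ Fin 2) (Fin 2 ⊕ Fin 2) F} : w ∈ SOplusGrp F 2 ↔ IsTensorAction w := by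
  have h : w ∈ SOplusGrp F 2 ↔ (IsUnit w ∧ PreservesTheta w) ∧ dickson w = 0 := by
    simp [SOplusGrp, OplusGrp, PreservesTheta, dickson]
  rw [h]
  constructor
  · rintro ⟨⟨hu, hw⟩, hδ⟩
    exact hw.isTensorAction hδ hu
  · rintro ⟨A, C, hA, hC, rfl⟩
    exact ⟨⟨IsUnit.of_mul_eq_one_right _ (tensorAction_adjugate_mul hA hC),
      preservesTheta_tensorAction hA hC⟩, dickson_tensorAction A C⟩

theorem sum_SOplusGrp_two {F : Type} [Field F] [Fintype F] [DecidableEq F] [CharP F 2]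
    (f : F → ℤ) :
    ∑ w ∈ SOplusGrp F 2, f w.trace =
      ∑ A ∈ detOne F, ∑ C ∈ detOne F, f (A.trace * C.trace) := by
  rw [← Finset.sum_product']
  symm
  refine Finset.sum_bij (fun p _ => tensorAction p.1 p.2) ?_ ?_ ?_ ?_
  · rintro ⟨A, C⟩ h
    rw [Finset.mem_product, mem_detOne, mem_detOne] at h
    exact mem_SOplusGrp_two.2 ⟨A, C, h.1, h.2, rfl⟩
  · rintro ⟨A, C⟩ h ⟨A', C'⟩ h' heq
    rw [Finset.mem_product, mem_detOne, mem_detOne] at h h'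
    exact Prod.ext_iff.2 (tensorAction_injective h.1 h'.1 h.2 h'.2 heq)
  · intro w hw
    obtain ⟨A, C, hA, hC, rfl⟩ := mem_SOplusGrp_two.1 hw
    exact ⟨(A, C), Finset.mem_product.2 ⟨mem_detOne.2 hA, mem_detOne.2 hC⟩, rfl⟩
  · intro p _
    rw [trace_tensorAction]

theorem stmt6 (r : ℕ) (hr : 1 ≤ r) (F : Type) [Field F] [Fintype F] [DecidableEq F]
    (hF : Fintype.card F = 2 ^ r) (a : F) (ha : a ≠ 0) :
    (∑ w ∈ SOplusGrp F 2, lam F r (a * Matrix.trace w) =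
      (2 ^ r : ℤ) ^ 2 * ((Kl F r a) ^ 2 + (2 ^ r : ℤ) ^ 3 - (2 ^ r : ℤ))) ∧
    (∑ w ∈ SOplusGrp F 2, lam F r (a * Matrix.trace w) =
      (2 ^ r : ℤ) ^ 2 * (Klm F r 2 a + (2 ^ r : ℤ) ^ 3)) := by
  have := charP_two_of_card hF
  have h := (sum_SOplusGrp_two fun t => lam F r (a * t)).trans
    (sum_detOne_sum_detOne_lam hr hF ha)
  refine ⟨h, h.trans ?_⟩
  rw [Kl_sq_eq hr hF ha]
  ring
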